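/- Let ≿ be a complete, transitive, and order-dense binary relation on a non-empty convex set X ⊆ ℝⁿ satisfying property (A), and suppose that all upper sections A≿(x) and all lower sections A≾(x) are separately convex. Then the following are equivalent: (i) graph continuity (≿ is a closed subset of X × X); (ii) continuity (every A≿(x) and every A≾(x) is closed in X); (iii) linear continuity (A≿(x) ∩ L and A≾(x) ∩ L are closed in L for every x and every straight line L in X); (iv) mixture continuity ({λ ∈ [0,1] : xλy ≿ z} and {λ ∈ [0,1] : z ≿ xλy} are closed for all x,y,z ∈ X); (v) Archimedean (for all x,y,z ∈ X with x ≻ y, there exist λ,δ ∈ (0,1) with xλz ≻ y and x ≻ yδz); (vi) strong IVP; (vii) IVP; (viii) Wold-continuity; (ix) weak Wold-continuity; (x) restricted solvability; (xi) separate continuity (A≿(x) ∩ L and A≾(x) ∩ L are closed in L for every x and every straight line L in X parallel to a coordinate axis). -/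

import Mathlib

open Set

/-- `L` is a straight line in `Y`: the intersection of `Y` with a
one-dimensional affine subspace of `ℝⁿ`. -/
def IsLineIn {n : ℕ} (Y L : Set (Fin n → ℝ)) : Prop :=
  ∃ (p v : Fin n → ℝ), v ≠ 0 ∧ L = Y ∩ {z | ∃ t : ℝ, z = p + t • v}

/-- `L` is a straight line in `Y` parallel to the `i`-th coordinate axis. -/
def IsAxisLineIn {n : ℕ} (Y L : Set (Fin n → ℝ)) : Prop :=
  ∃ (p : Fin n → ℝ) (i : Fin n), L = Y ∩ {z | ∃ t : ℝ, z = p + t • (Pi.single i 1 : Fin n → ℝ)}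

/-- `A` is separately convex in `Y`. -/
def SepConvexIn {n : ℕ} (Y A : Set (Fin n → ℝ)) : Prop :=
  ∀ L, IsAxisLineIn Y L → Convex ℝ (A ∩ L)

/-- Property (A): `Y` is open or a product of subsets of `ℝ`. -/
def PropertyA {n : ℕ} (Y : Set (Fin n → ℝ)) : Prop :=
  IsOpen Y ∨ ∃ Yi : Fin n → Set ℝ, Y = Set.univ.pi Yi

/-- Strict preference `x ≻ y`. -/
def SPref {n : ℕ} (R : (Fin n → ℝ) → (Fin n → ℝ) → Prop) (x y : Fin n → ℝ) : Prop :=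
  R x y ∧ ¬ R y x

/-- Indifference `x ∼ y`. -/
def Indiff {n : ℕ} (R : (Fin n → ℝ) → (Fin n → ℝ) → Prop) (x y : Fin n → ℝ) : Prop :=
  R x y ∧ R y x

/-- `R` is order dense on `X`. -/
def OrderDense {n : ℕ} (X : Set (Fin n → ℝ))
    (R : (Fin n → ℝ) → (Fin n → ℝ) → Prop) : Prop :=
  ∀ x ∈ X, ∀ y ∈ X, SPref R x y → ∃ z ∈ X, SPref R x z ∧ SPref R z y

/-- `C` is a curve in `X` joining `x` to `y`: the image of a continuous injective
map `m : [0,1] → X` with `m 0 = x` and `m 1 = y`. -/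
def IsCurveJoining {n : ℕ} (X : Set (Fin n → ℝ)) (x y : Fin n → ℝ)
    (C : Set (Fin n → ℝ)) : Prop :=
  ∃ m : Set.Icc (0 : ℝ) 1 → (Fin n → ℝ), Continuous m ∧ Function.Injective m ∧
    Set.range m ⊆ X ∧ m ⟨0, by norm_num⟩ = x ∧ m ⟨1, by norm_num⟩ = y ∧
      C = Set.range m

/-- `R` is restricted solvable on `X`. -/
def RestrictedSolvable {n : ℕ} (X : Set (Fin n → ℝ))
    (R : (Fin n → ℝ) → (Fin n → ℝ) → Prop) : Prop :=
  ∀ (i : Fin n), ∀ x ∈ X, ∀ (y : Fin n → ℝ) (a b : ℝ),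
    Function.update y i a ∈ X → Function.update y i b ∈ X →
      R (Function.update y i a) x → R x (Function.update y i b) →
        ∃ c : ℝ, Function.update y i c ∈ X ∧ Indiff R x (Function.update y i c)

open Function Filter Topology

/-- `S` meets every line parallel to a coordinate axis in an order-connected set. -/
def SepOrdConnected {n : ℕ} (S : Set (Fin n → ℝ)) : Prop :=
  ∀ (w : Fin n → ℝ) (i : Fin n) (a b : ℝ), update w i a ∈ S → update w i b ∈ S →
    ∀ t ∈ Icc a b, update w i t ∈ S

/-- `S` is relatively open in `X` along every line parallel to a coordinate axis. -/
def SepOpenIn {n : ℕ} (X S : Set (Fin n → ℝ)) : Prop :=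
  ∀ p ∈ S, ∀ i : Fin n, ∀ᶠ t in 𝓝[{t | update p i t ∈ X}] (p i), update p i t ∈ S

theorem update_eq_add_smul_single {n : ℕ} (w : Fin n → ℝ) (i : Fin n) (t : ℝ) :
    update w i t = w + (t - w i) • (Pi.single i 1 : Fin n → ℝ) := by
  ext j
  rcases eq_or_ne j i with rfl | h
  · simp
  · simp [h]

theorem smul_update_add_smul_update {n : ℕ} (w : Fin n → ℝ) (i : Fin n) (l a b : ℝ) :
    l • update w i a + (1 - l) • update w i b = update w i (l * a + (1 - l) * b) := by
  ext j
  rcases eq_or_ne j i with rfl | h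
  · simp
  · simp only [Pi.add_apply, Pi.smul_apply, smul_eq_mul, update_of_ne h]
    ring

theorem continuous_update_coord {n : ℕ} (w : Fin n → ℝ) (i : Fin n) :
    Continuous fun t : ℝ => update w i t :=
  continuous_const.update i continuous_id

theorem update_mem_line {n : ℕ} (w : Fin n → ℝ) (i : Fin n) (t : ℝ) :
    update w i t ∈ {z | ∃ t : ℝ, z = w + t • (Pi.single i 1 : Fin n → ℝ)} :=
  ⟨_, update_eq_add_smul_single w i t⟩

theorem Convex.smul_add_one_sub_smul_mem {n : ℕ} {X : Set (Fin n → ℝ)} (hX : Convex ℝ X)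
    {x y : Fin n → ℝ} (hx : x ∈ X) (hy : y ∈ X) {l : ℝ} (hl : l ∈ Icc (0 : ℝ) 1) :
    l • x + (1 - l) • y ∈ X :=
  hX hx hy hl.1 (sub_nonneg.2 hl.2) (by ring)

theorem exists_weight {a b t : ℝ} (ht : t ∈ Icc a b) :
    ∃ l ∈ Icc (0 : ℝ) 1, l * a + (1 - l) * b = t := by
  have h : t ∈ segment ℝ a b := by rwa [segment_eq_Icc (ht.1.trans ht.2)]
  obtain ⟨l, m, hl, hm, hlm, rfl⟩ := h
  exact ⟨l, ⟨hl, by linarith⟩, by simp [← hlm]⟩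

theorem SepConvexIn.sepOrdConnected {n : ℕ} {X S : Set (Fin n → ℝ)} (hSX : S ⊆ X)
    (h : SepConvexIn X S) : SepOrdConnected S := by
  intro w i a b ha hb t ht
  obtain ⟨l, hl, rfl⟩ := exists_weight ht
  rw [← smul_update_add_smul_update]
  exact ((h _ ⟨w, i, rfl⟩).smul_add_one_sub_smul_mem ⟨ha, hSX ha, update_mem_line w i a⟩
    ⟨hb, hSX hb, update_mem_line w i b⟩ hl).1

theorem Icc_mem_nhdsWithin_of_extreme {T : Set ℝ} {a p b : ℝ} (ha : a ≤ p) (hb : p ≤ b)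
    (ha' : a < p ∨ ∀ q ∈ T, p ≤ q) (hb' : p < b ∨ ∀ q ∈ T, q ≤ p) : Icc a b ∈ 𝓝[T] p := by
  have h1 : ∀ᶠ q in 𝓝[T] p, a ≤ q := by
    rcases ha' with h | h
    · exact (eventually_ge_nhds h).filter_mono nhdsWithin_le_nhds
    · filter_upwards [self_mem_nhdsWithin] with q hq using ha.trans (h q hq)
  have h2 : ∀ᶠ q in 𝓝[T] p, q ≤ b := by
    rcases hb' with h | h
    · exact (eventually_le_nhds h).filter_mono nhdsWithin_le_nhds
    · filter_upwards [self_mem_nhdsWithin] with q hq using (h q hq).trans hb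
  exact h1.and h2

/-- If from `p` one can move a little towards every point of `T` while remaining in `G`, then some
interval with endpoints in `G` is a neighbourhood of `p` in `T`. -/
theorem exists_Icc_mem_nhdsWithin {T G : Set ℝ} {p : ℝ} (hp : p ∈ G)
    (h : ∀ q ∈ T, ∃ d ∈ Ioo (0 : ℝ) 1, d * p + (1 - d) * q ∈ G) :
    ∃ a ∈ G, ∃ b ∈ G, a ≤ p ∧ p ≤ b ∧ Icc a b ∈ 𝓝[T] p := by
  obtain ⟨a, haG, hap, ha⟩ : ∃ a ∈ G, a ≤ p ∧ (a < p ∨ ∀ q ∈ T, p ≤ q) := by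
    by_cases hq : ∃ q ∈ T, q < p
    · obtain ⟨q, hqT, hqp⟩ := hq
      obtain ⟨d, hd, hdG⟩ := h q hqT
      have : d * p + (1 - d) * q < p := by nlinarith [hd.2]
      exact ⟨_, hdG, this.le, Or.inl this⟩
    · push Not at hq
      exact ⟨p, hp, le_rfl, Or.inr hq⟩
  obtain ⟨b, hbG, hpb, hb⟩ : ∃ b ∈ G, p ≤ b ∧ (p < b ∨ ∀ q ∈ T, q ≤ p) := by
    by_cases hq : ∃ q ∈ T, p < q
    · obtain ⟨q, hqT, hqp⟩ := hq
      obtain ⟨d, hd, hdG⟩ := h q hqT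
      have : p < d * p + (1 - d) * q := by nlinarith [hd.2]
      exact ⟨_, hdG, this.le, Or.inl this⟩
    · push Not at hq
      exact ⟨p, hp, le_rfl, Or.inr hq⟩
  exact ⟨a, haG, b, hbG, hap, hpb, Icc_mem_nhdsWithin_of_extreme hap hpb ha hb⟩

theorem exists_Icc_mem_nhdsWithin_of_convex {T G : Set ℝ} {p : ℝ} (hT : Convex ℝ T) (hp : p ∈ T)
    (hG : G ∈ 𝓝[T] p) : ∃ a ∈ G, ∃ b ∈ G, a ≤ p ∧ p ≤ b ∧ Icc a b ∈ 𝓝[T] p := by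
  refine exists_Icc_mem_nhdsWithin (mem_of_mem_nhdsWithin hp hG) fun q hq => ?_
  have hlim : Tendsto (fun d : ℝ => d * p + (1 - d) * q) (𝓝[<] 1) (𝓝[T] p) := by
    refine tendsto_nhdsWithin_iff.2 ⟨?_, ?_⟩
    · have : Continuous fun d : ℝ => d * p + (1 - d) * q := by fun_prop
      simpa using (this.tendsto 1).mono_left (nhdsWithin_le_nhds (s := Iio (1 : ℝ)))
    · filter_upwards [Ioo_mem_nhdsLT (zero_lt_one' ℝ)] with d hd
      exact hT hp hq hd.1.le (sub_nonneg.2 hd.2.le) (by ring)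
  obtain ⟨d, hd, hdG⟩ :=
    Filter.nonempty_of_mem (inter_mem (Ioo_mem_nhdsLT (zero_lt_one' ℝ)) (hlim hG))
  exact ⟨d, hd, hdG⟩

/-- Property (A) makes a convex set locally a product of intervals. -/
theorem PropertyA.exists_pi_mem_nhdsWithin {n : ℕ} {X : Set (Fin n → ℝ)} (hXA : PropertyA X)
    (hX : Convex ℝ X) {p : Fin n → ℝ} (hp : p ∈ X) :
    ∃ Y : Fin n → Set ℝ, univ.pi Y ⊆ X ∧ univ.pi Y ∈ 𝓝[X] p ∧ (∀ i, Convex ℝ (Y i)) ∧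
      ∀ i, p i ∈ Y i := by
  rcases hXA with hopen | ⟨Y, rfl⟩
  · obtain ⟨ε, hε, hball⟩ := Metric.isOpen_iff.1 hopen p hp
    rw [ball_pi p hε] at hball
    refine ⟨fun i => Metric.ball (p i) ε, hball, mem_nhdsWithin_of_mem_nhds ?_,
      fun i => convex_ball _ _, fun i => Metric.mem_ball_self hε⟩
    rw [← ball_pi p hε]
    exact Metric.ball_mem_nhds p hε
  · refine ⟨Y, Subset.rfl, self_mem_nhdsWithin, fun i => ?_, fun i => hp i (mem_univ i)⟩
    have hne : (univ.pi Y).Nonempty := ⟨p, hp⟩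
    rw [← eval_image_univ_pi hne]
    exact hX.is_linear_image (IsLinearMap.mk (fun _ _ => rfl) fun _ _ => rfl)

theorem SepOrdConnected.Icc_subset {n : ℕ} {S : Set (Fin n → ℝ)} (hS : SepOrdConnected S)
    {a b : Fin n → ℝ} (hab : a ≤ b) (hcorner : ∀ w, (∀ i, w i = a i ∨ w i = b i) → w ∈ S) :
    Icc a b ⊆ S := by
  have key : ∀ (s : Finset (Fin n)) (w : Fin n → ℝ), w ∈ Icc a b →
      (∀ i ∉ s, w i = a i ∨ w i = b i) → w ∈ S := by
    intro s
    induction s using Finset.induction_on with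
    | empty => exact fun w _ h => hcorner w fun i => h i (Finset.notMem_empty i)
    | insert j s _ ih =>
      intro w hw h
      have aux : ∀ c, (c = a j ∨ c = b j) → update w j c ∈ S := by
        intro c hc
        refine ih _ ⟨le_update_iff.2 ⟨?_, fun k _ => hw.1 k⟩,
          update_le_iff.2 ⟨?_, fun k _ => hw.2 k⟩⟩ fun i hi => ?_
        · rcases hc with rfl | rfl
          exacts [le_rfl, hab j]
        · rcases hc with rfl | rfl
          exacts [hab j, le_rfl]
        · rcases eq_or_ne i j with rfl | hij
          · simpa using hc
          · rw [update_of_ne hij]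
            exact h i (by simp [hij, hi])
      have := hS w j (a j) (b j) (aux _ (Or.inl rfl)) (aux _ (Or.inr rfl)) (w j) ⟨hw.1 j, hw.2 j⟩
      rwa [update_eq_self] at this
  exact fun w hw => key Finset.univ w hw fun i hi => absurd (Finset.mem_univ i) hi

theorem finite_corners {n : ℕ} (a b : Fin n → ℝ) :
    {w : Fin n → ℝ | ∀ i, w i = a i ∨ w i = b i}.Finite := by
  refine (Set.Finite.pi (t := fun i => ({a i, b i} : Set ℝ)) fun i => toFinite _).subset ?_
  intro w hw i _
  exact hw i

/-- Separate openness and separate order-connectedness together yield joint openness. -/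
theorem SepOpenIn.mem_nhdsWithin {n : ℕ} {X S : Set (Fin n → ℝ)} (hX : Convex ℝ X)
    (hXA : PropertyA X) (hSo : SepOpenIn X S) (hSc : SepOrdConnected S) (hSX : S ⊆ X)
    {p : Fin n → ℝ} (hp : p ∈ S) : S ∈ 𝓝[X] p := by
  obtain ⟨Y, hYX, hYp, hYc, hpY⟩ := hXA.exists_pi_mem_nhdsWithin hX (hSX hp)
  have key : ∀ s : Finset (Fin n), ∃ a b : Fin n → ℝ, a ≤ p ∧ p ≤ b ∧
      (∀ i, a i ∈ Y i) ∧ (∀ i, b i ∈ Y i) ∧ (∀ i ∉ s, a i = p i ∧ b i = p i) ∧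
      (∀ i ∈ s, Icc (a i) (b i) ∈ 𝓝[Y i] (p i)) ∧
      ∀ w, (∀ i, w i = a i ∨ w i = b i) → w ∈ S := by
    intro s
    induction s using Finset.induction_on with
    | empty =>
      refine ⟨p, p, le_rfl, le_rfl, hpY, hpY, by simp, by simp, fun w hw => ?_⟩
      have : w = p := funext fun i => by simpa using hw i
      rwa [this]
    | insert j s hj ih =>
      obtain ⟨a, b, hap, hpb, haY, hbY, hout, hin, hcor⟩ := ih
      have hev : ∀ᶠ t in 𝓝[Y j] (p j), t ∈ Y j ∧
          ∀ w ∈ {w : Fin n → ℝ | ∀ i, w i = a i ∨ w i = b i}, update w j t ∈ S := by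
        refine eventually_mem_nhdsWithin.and ((finite_corners a b).eventually_all.2 ?_)
        intro w hw
        have hwj : w j = p j := by
          rcases hw j with h | h
          exacts [h.trans (hout j hj).1, h.trans (hout j hj).2]
        have h := hSo w (hcor w hw) j
        rw [hwj] at h
        refine h.filter_mono (nhdsWithin_mono (p j) fun t ht => ?_)
        refine hYX (a := update w j t) fun i _ => ?_
        rcases eq_or_ne i j with rfl | hij
        · simpa using ht
        · rw [update_of_ne hij]
          rcases hw i with h | h <;> rw [h]
          exacts [haY i, hbY i]
      obtain ⟨c, ⟨hcY, hc⟩, d, ⟨hdY, hd⟩, hcp, hpd, hcd⟩ :=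
        exists_Icc_mem_nhdsWithin_of_convex (hYc j) (hpY j) hev
      refine ⟨update a j c, update b j d, update_le_iff.2 ⟨hcp, fun k _ => hap k⟩,
        le_update_iff.2 ⟨hpd, fun k _ => hpb k⟩, ?_, ?_, ?_, ?_, ?_⟩
      · intro i
        rcases eq_or_ne i j with rfl | hij
        · simpa using hcY
        · simpa [hij] using haY i
      · intro i
        rcases eq_or_ne i j with rfl | hij
        · simpa using hdY
        · simpa [hij] using hbY i
      · intro i hi
        rw [Finset.mem_insert, not_or] at hi
        simpa [hi.1] using hout i hi.2
      · intro i hi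
        rcases eq_or_ne i j with rfl | hij
        · simpa using hcd
        · simpa [hij] using hin i (Finset.mem_of_mem_insert_of_ne hi hij)
      · intro w hw
        have hmem : update w j (a j) ∈ {w : Fin n → ℝ | ∀ i, w i = a i ∨ w i = b i} := by
          intro i
          rcases eq_or_ne i j with rfl | hij
          · simp
          · simpa [hij] using hw i
        have hwj := hw j
        simp only [update_self] at hwj
        rcases hwj with h | h
        · simpa [← h] using hc _ hmem
        · simpa [← h] using hd _ hmem
  obtain ⟨a, b, hap, hpb, -, -, -, hin, hcor⟩ := key Finset.univ
  refine mem_of_superset ?_ (hSc.Icc_subset (hap.trans hpb) hcor)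
  have hpi : Icc a b ∈ 𝓝[univ.pi Y] p := by
    rw [nhdsWithin_pi_univ_eq, ← pi_univ_Icc]
    exact pi_mem_pi finite_univ fun i _ => hin i (Finset.mem_univ i)
  exact nhdsWithin_le_of_mem hYp hpi

/-- `R` is a complete, transitive and order dense relation on `X`. -/
structure IsDensePreorderOn {n : ℕ} (X : Set (Fin n → ℝ))
    (R : (Fin n → ℝ) → (Fin n → ℝ) → Prop) : Prop where
  comp : ∀ x ∈ X, ∀ y ∈ X, R x y ∨ R y x
  trans : ∀ x ∈ X, ∀ y ∈ X, ∀ z ∈ X, R x y → R y z → R x z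
  dense : OrderDense X R

namespace IsDensePreorderOn

variable {n : ℕ} {X : Set (Fin n → ℝ)} {R : (Fin n → ℝ) → (Fin n → ℝ) → Prop}

theorem swap (h : IsDensePreorderOn X R) : IsDensePreorderOn X fun a b => R b a where
  comp x hx y hy := h.comp y hy x hx
  trans x hx y hy z hz h1 h2 := h.trans z hz y hy x hx h2 h1
  dense x hx y hy hxy := by
    obtain ⟨z, hz, h1, h2⟩ := h.dense y hy x hx hxy
    exact ⟨z, hz, h2, h1⟩

theorem spref_of_not (h : IsDensePreorderOn X R) {x y : Fin n → ℝ} (hx : x ∈ X) (hy : y ∈ X)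
    (hxy : ¬ R x y) : SPref R y x :=
  ⟨(h.comp x hx y hy).resolve_left hxy, hxy⟩

theorem spref_of_spref_of_le (h : IsDensePreorderOn X R) {x y z : Fin n → ℝ} (hx : x ∈ X)
    (hy : y ∈ X) (hz : z ∈ X) (hxy : SPref R x y) (hyz : R y z) : SPref R x z :=
  ⟨h.trans x hx y hy z hz hxy.1 hyz, fun hzx => hxy.2 (h.trans y hy z hz x hx hyz hzx)⟩

theorem sepOrdConnected_strictLower (h : IsDensePreorderOn X R)
    (hL : ∀ x ∈ X, SepOrdConnected {y ∈ X | R x y}) {x : Fin n → ℝ} (hx : x ∈ X) :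
    SepOrdConnected {y ∈ X | SPref R x y} := by
  intro w i a b ha hb t ht
  obtain ⟨z, hz, hxz, hza, hzb⟩ :
      ∃ z ∈ X, SPref R x z ∧ R z (update w i a) ∧ R z (update w i b) := by
    rcases h.comp _ ha.1 _ hb.1 with hab | hab
    · exact ⟨_, ha.1, ha.2, (h.comp _ ha.1 _ ha.1).elim id id, hab⟩
    · exact ⟨_, hb.1, hb.2, hab, (h.comp _ hb.1 _ hb.1).elim id id⟩
  have := hL z hz w i a b ⟨ha.1, hza⟩ ⟨hb.1, hzb⟩ t ht
  exact ⟨this.1, h.spref_of_spref_of_le hx hz this.1 hxz this.2⟩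

theorem sepOpenIn_strictLower_of_isClosed (h : IsDensePreorderOn X R) {x : Fin n → ℝ} (hx : x ∈ X)
    (hcl : ∀ L, IsAxisLineIn X L → IsClosed (Subtype.val ⁻¹' {y | R y x} : Set L)) :
    SepOpenIn X {y ∈ X | SPref R x y} := by
  intro p hp i
  obtain ⟨U, hU, hUeq⟩ := isOpen_induced_iff.1 (hcl _ ⟨p, i, rfl⟩).isOpen_compl
  have hiff : ∀ t (_ : update p i t ∈ X), update p i t ∈ U ↔ ¬ R (update p i t) x := fun t ht =>
    Set.ext_iff.1 hUeq ⟨update p i t, ht, update_mem_line p i t⟩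
  have hpU : update p i (p i) ∈ U := by
    refine (hiff _ ?_).2 ?_ <;> rw [update_eq_self]
    exacts [hp.1, hp.2.2]
  have hev := (continuous_update_coord p i).continuousAt.eventually (hU.mem_nhds hpU)
  filter_upwards [self_mem_nhdsWithin, nhdsWithin_le_nhds hev] with t ht htU
  exact ⟨ht, h.spref_of_not ht hx ((hiff t ht).1 htU)⟩

theorem sepOpenIn_strictLower_of_archimedean (h : IsDensePreorderOn X R) (hX : Convex ℝ X)
    (hL : ∀ x ∈ X, SepOrdConnected {y ∈ X | R x y}) {x : Fin n → ℝ} (hx : x ∈ X)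
    (harch : ∀ y ∈ X, ∀ z ∈ X, SPref R x y →
      ∃ d ∈ Ioo (0 : ℝ) 1, SPref R x (d • y + (1 - d) • z)) :
    SepOpenIn X {y ∈ X | SPref R x y} := by
  intro p hp i
  have hpG : p i ∈ {t | update p i t ∈ {y ∈ X | SPref R x y}} := by simpa using hp
  obtain ⟨a, ha, b, hb, -, -, hab⟩ := exists_Icc_mem_nhdsWithin
    (T := {t | update p i t ∈ X}) hpG fun q hq => by
      obtain ⟨d, hd, hdx⟩ := harch _ hpG.1 _ hq hpG.2
      refine ⟨d, hd, ?_⟩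
      rw [mem_ofPred_eq, ← smul_update_add_smul_update]
      exact ⟨hX.smul_add_one_sub_smul_mem hpG.1 hq ⟨hd.1.le, hd.2.le⟩, hdx⟩
  filter_upwards [hab] with t ht
  exact h.sepOrdConnected_strictLower hL hx p i a b ha hb t ht

theorem sepOpenIn_strictLower_of_restrictedSolvable (h : IsDensePreorderOn X R)
    (hU : ∀ x ∈ X, SepOrdConnected {y ∈ X | R y x})
    (hL : ∀ x ∈ X, SepOrdConnected {y ∈ X | R x y})
    (hrs : RestrictedSolvable X R) {x : Fin n → ℝ} (hx : x ∈ X) :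
    SepOpenIn X {y ∈ X | SPref R x y} := by
  intro p hp i
  by_cases hs : ∃ s, update p i s ∈ X ∧ R (update p i s) x
  swap
  · push Not at hs
    filter_upwards [self_mem_nhdsWithin] with t ht
    exact ⟨ht, h.spref_of_not ht hx (hs t ht)⟩
  obtain ⟨s, hsX, hsx⟩ := hs
  obtain ⟨z, hz, hxz, hzp⟩ := h.dense x hx p hp.1 hp.2
  have hp' : update p i (p i) = p := update_eq_self i p
  obtain ⟨c, hcX, hzc, hcz⟩ := hrs i z hz p s (p i) hsX (hp'.symm ▸ hp.1)
    (h.trans _ hsX _ hx _ hz hsx hxz.1) (hp'.symm ▸ hzp.1)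
  have below : ∀ t, update p i t ∈ X → ¬ SPref R x (update p i t) → R (update p i t) z := by
    intro t ht hxt
    by_contra hn
    exact hxt (h.spref_of_spref_of_le hx hz ht hxz (h.spref_of_not ht hz hn).1)
  have outside : ∀ t, update p i t ∈ X → ¬ SPref R x (update p i t) → ¬ R z (update p i t) :=
    fun t ht hxt hzt => hxt (h.spref_of_spref_of_le hx hz ht hxz hzt)
  have hpn : ¬ R (update p i (p i)) z := hp'.symm ▸ hzp.2
  have hpz : R z (update p i (p i)) := hp'.symm ▸ hzp.1
  have hpX : update p i (p i) ∈ X := hp'.symm ▸ hp.1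
  rcases lt_trichotomy c (p i) with hc | rfl | hc
  · filter_upwards [self_mem_nhdsWithin, nhdsWithin_le_nhds (lt_mem_nhds hc)] with t ht hct
    refine ⟨ht, by_contra fun hxt => ?_⟩
    rcases le_total t (p i) with htp | htp
    · exact outside t ht hxt (hL z hz p i c (p i) ⟨hcX, hzc⟩ ⟨hpX, hpz⟩ t ⟨le_of_lt hct, htp⟩).2
    · exact hpn (hU z hz p i c t ⟨hcX, hcz⟩ ⟨ht, below t ht hxt⟩ (p i) ⟨hc.le, htp⟩).2
  · exact absurd hcz hpn
  · filter_upwards [self_mem_nhdsWithin, nhdsWithin_le_nhds (gt_mem_nhds hc)] with t ht hct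
    refine ⟨ht, by_contra fun hxt => ?_⟩
    rcases le_total t (p i) with htp | htp
    · exact hpn (hU z hz p i t c ⟨ht, below t ht hxt⟩ ⟨hcX, hcz⟩ (p i) ⟨htp, hc.le⟩).2
    · exact outside t ht hxt (hL z hz p i (p i) c ⟨hpX, hpz⟩ ⟨hcX, hzc⟩ t ⟨htp, le_of_lt hct⟩).2

/-- Openness of all strict sections along coordinate lines gives a closed graph. -/
theorem isClosed_graph (h : IsDensePreorderOn X R) (hX : Convex ℝ X) (hXA : PropertyA X)
    (hU : ∀ x ∈ X, SepOrdConnected {y ∈ X | R y x})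
    (hL : ∀ x ∈ X, SepOrdConnected {y ∈ X | R x y})
    (hoU : ∀ x ∈ X, SepOpenIn X {y ∈ X | SPref R y x})
    (hoL : ∀ x ∈ X, SepOpenIn X {y ∈ X | SPref R x y}) :
    IsClosed {p : X × X | R (p.1 : Fin n → ℝ) (p.2 : Fin n → ℝ)} := by
  rw [← isOpen_compl_iff, isOpen_iff_mem_nhds]
  rintro ⟨⟨x, hx⟩, ⟨y, hy⟩⟩ hxy
  obtain ⟨z, hz, hyz, hzx⟩ := h.dense y hy x hx (h.spref_of_not hx hy hxy)
  have h1 : {w ∈ X | SPref R w z} ∈ 𝓝[X] y := (hoU z hz).mem_nhdsWithin hX hXA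
    (h.swap.sepOrdConnected_strictLower hU hz) (sep_subset _ _) ⟨hy, hyz⟩
  have h2 : {w ∈ X | SPref R z w} ∈ 𝓝[X] x := (hoL z hz).mem_nhdsWithin hX hXA
    (h.sepOrdConnected_strictLower hL hz) (sep_subset _ _) ⟨hx, hzx⟩
  have h1' := preimage_coe_mem_nhds_subtype (a := ⟨y, hy⟩) |>.2 h1
  have h2' := preimage_coe_mem_nhds_subtype (a := ⟨x, hx⟩) |>.2 h2
  filter_upwards [prod_mem_nhds h2' h1'] with q hq hR
  exact hq.2.2.2 (h.trans z hz _ hq.1.1 _ hq.2.1 hq.1.2.1 hR)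

theorem exists_indiff_of_curve (h : IsDensePreorderOn X R)
    (hcl : ∀ x ∈ X, IsClosed (Subtype.val ⁻¹' {y | R y x} : Set X) ∧
        IsClosed (Subtype.val ⁻¹' {y | R x y} : Set X))
    {x y z : Fin n → ℝ} (hy : y ∈ X) (hxy : R x y) (hyz : R y z)
    {C : Set (Fin n → ℝ)} (hC : IsCurveJoining X x z C) : ∃ c ∈ C, Indiff R c y := by
  obtain ⟨m, hm, -, hmX, rfl, rfl, rfl⟩ := hC
  have hmX' : ∀ t, m t ∈ X := fun t => hmX (mem_range_self t)
  have hcont : Continuous fun t => (⟨m t, hmX' t⟩ : X) := hm.subtype_mk _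
  have hpre : IsPreconnected (univ : Set (Icc (0 : ℝ) 1)) := isPreconnected_univ
  obtain ⟨t, -, h1, h2⟩ := isPreconnected_closed_iff.1 hpre _ _ ((hcl y hy).1.preimage hcont)
    ((hcl y hy).2.preimage hcont) (fun t _ => h.comp _ (hmX' t) _ hy) ⟨_, mem_univ _, hxy⟩
    ⟨_, mem_univ _, hyz⟩
  exact ⟨m t, mem_range_self t, h1, h2⟩

end IsDensePreorderOn

/-- The points of the curve are convex combinations of its endpoints. -/
theorem exists_isCurveJoining_segment {n : ℕ} {X : Set (Fin n → ℝ)} (hX : Convex ℝ X)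
    {x y : Fin n → ℝ} (hx : x ∈ X) (hy : y ∈ X) (hxy : x ≠ y) :
    ∃ C, IsCurveJoining X x y C ∧ ∀ c ∈ C, ∃ l ∈ Icc (0 : ℝ) 1, c = l • x + (1 - l) • y := by
  have hw : ∀ t ∈ Icc (0 : ℝ) 1, 1 - t ∈ Icc (0 : ℝ) 1 := fun t ht =>
    ⟨by linarith [ht.2], by linarith [ht.1]⟩
  refine ⟨range fun t : Icc (0 : ℝ) 1 => (1 - (t : ℝ)) • x + (1 - (1 - (t : ℝ))) • y,
    ⟨_, by fun_prop, ?_, ?_, by simp, by simp, rfl⟩, ?_⟩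
  · intro s t hst
    have : ((t : ℝ) - s) • (x - y) = 0 := by
      have := sub_eq_zero.2 hst
      rw [← this]
      module
    rcases smul_eq_zero.1 this with h | h
    · exact Subtype.ext (by linarith)
    · exact absurd (sub_eq_zero.1 h) hxy
  · rintro _ ⟨t, rfl⟩
    exact hX.smul_add_one_sub_smul_mem hx hy (hw t t.2)
  · rintro _ ⟨t, rfl⟩
    exact ⟨_, hw t t.2, rfl⟩

theorem exists_weight_spref_of_isClosed {n : ℕ} {X : Set (Fin n → ℝ)}
    {R : (Fin n → ℝ) → (Fin n → ℝ) → Prop} (h : IsDensePreorderOn X R) (hX : Convex ℝ X)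
    {x y z : Fin n → ℝ} (hx : x ∈ X) (hy : y ∈ X) (hz : z ∈ X) (hxy : SPref R x y)
    (hcl : IsClosed {l : ℝ | l ∈ Icc (0 : ℝ) 1 ∧ R y (l • x + (1 - l) • z)}) :
    ∃ l ∈ Ioo (0 : ℝ) 1, SPref R (l • x + (1 - l) • z) y := by
  have h1 : (1 : ℝ) ∈ {l : ℝ | l ∈ Icc (0 : ℝ) 1 ∧ R y (l • x + (1 - l) • z)}ᶜ := by
    simpa using hxy.2
  obtain ⟨l, hl, hn⟩ := Filter.nonempty_of_mem (inter_mem (Ioo_mem_nhdsLT (zero_lt_one' ℝ))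
    (nhdsWithin_le_nhds (hcl.isOpen_compl.mem_nhds h1)))
  have hl' : l ∈ Icc (0 : ℝ) 1 := ⟨hl.1.le, hl.2.le⟩
  exact ⟨l, hl, h.spref_of_not hy (hX.smul_add_one_sub_smul_mem hx hz hl') fun hR => hn ⟨hl', hR⟩⟩

theorem isClosed_weights {n : ℕ} {X : Set (Fin n → ℝ)} (hX : Convex ℝ X) {x y : Fin n → ℝ}
    (hx : x ∈ X) (hy : y ∈ X) {A : Set (Fin n → ℝ)} (hA : IsClosed (Subtype.val ⁻¹' A : Set X)) :
    IsClosed {l : ℝ | l ∈ Icc (0 : ℝ) 1 ∧ l • x + (1 - l) • y ∈ A} := by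
  obtain ⟨B, hB, hBA⟩ := isClosed_induced_iff.1 hA
  have : {l : ℝ | l ∈ Icc (0 : ℝ) 1 ∧ l • x + (1 - l) • y ∈ A} =
      Icc (0 : ℝ) 1 ∩ (fun l : ℝ => l • x + (1 - l) • y) ⁻¹' B := by
    ext l
    exact and_congr_right fun hl =>
      (Set.ext_iff.1 hBA ⟨_, hX.smul_add_one_sub_smul_mem hx hy hl⟩).symm
  rw [this]
  exact isClosed_Icc.inter (hB.preimage (by fun_prop))

/-- Theorem 3(b): let `≿` (written `R`) be a complete, transitive and order-dense
binary relation on a non-empty convex set `X ⊆ ℝⁿ` with property (A) whose upper and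
lower sections are all separately convex.  Then graph continuity, continuity,
linear continuity, mixture continuity, the Archimedean property, the strong IVP,
the IVP, Wold-continuity, weak Wold-continuity, restricted solvability, and
separate continuity are all equivalent. -/
theorem theorem3b {n : ℕ} {X : Set (Fin n → ℝ)}
    (hXne : X.Nonempty) (hXconv : Convex ℝ X) (hXA : PropertyA X)
    (R : (Fin n → ℝ) → (Fin n → ℝ) → Prop)
    (hcomp : ∀ x ∈ X, ∀ y ∈ X, R x y ∨ R y x)
    (htrans : ∀ x ∈ X, ∀ y ∈ X, ∀ z ∈ X, R x y → R y z → R x z)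
    (hdense : OrderDense X R)
    (hscU : ∀ x ∈ X, SepConvexIn X {y ∈ X | R y x})
    (hscL : ∀ x ∈ X, SepConvexIn X {y ∈ X | R x y}) :
    List.TFAE [
      -- (i) graph continuity
      IsClosed {p : X × X | R (p.1 : Fin n → ℝ) (p.2 : Fin n → ℝ)},
      -- (ii) continuity
      ∀ x ∈ X, IsClosed (Subtype.val ⁻¹' {y | R y x} : Set X) ∧
        IsClosed (Subtype.val ⁻¹' {y | R x y} : Set X),
      -- (iii) linear continuity
      ∀ x ∈ X, ∀ L, IsLineIn X L →
        IsClosed (Subtype.val ⁻¹' {y | R y x} : Set L) ∧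
          IsClosed (Subtype.val ⁻¹' {y | R x y} : Set L),
      -- (iv) mixture continuity
      ∀ x ∈ X, ∀ y ∈ X, ∀ z ∈ X,
        IsClosed {l : ℝ | l ∈ Icc (0 : ℝ) 1 ∧ R (l • x + (1 - l) • y) z} ∧
          IsClosed {l : ℝ | l ∈ Icc (0 : ℝ) 1 ∧ R z (l • x + (1 - l) • y)},
      -- (v) Archimedean
      ∀ x ∈ X, ∀ y ∈ X, ∀ z ∈ X, SPref R x y →
        (∃ l ∈ Ioo (0 : ℝ) 1, SPref R (l • x + (1 - l) • z) y) ∧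
          (∃ d ∈ Ioo (0 : ℝ) 1, SPref R x (d • y + (1 - d) • z)),
      -- (vi) strong IVP
      ∀ x ∈ X, ∀ y ∈ X, ∀ z ∈ X, R x y → R y z →
        ∀ C, IsCurveJoining X x z C → ∃ c ∈ C, Indiff R c y,
      -- (vii) IVP
      ∀ x ∈ X, ∀ y ∈ X, ∀ z ∈ X, R x y → R y z →
        ∃ l ∈ Icc (0 : ℝ) 1, Indiff R (l • x + (1 - l) • z) y,
      -- (viii) Wold-continuity
      OrderDense X R ∧ ∀ x ∈ X, ∀ z ∈ X, ∀ y ∈ X, SPref R x z → SPref R z y →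
        ∀ C, IsCurveJoining X x y C → ∃ c ∈ C, Indiff R c z,
      -- (ix) weak Wold-continuity
      OrderDense X R ∧ ∀ x ∈ X, ∀ z ∈ X, ∀ y ∈ X, SPref R x z → SPref R z y →
        ∃ l ∈ Icc (0 : ℝ) 1, Indiff R (l • x + (1 - l) • y) z,
      -- (x) restricted solvability
      RestrictedSolvable X R,
      -- (xi) separate continuity
      ∀ x ∈ X, ∀ L, IsAxisLineIn X L →
        IsClosed (Subtype.val ⁻¹' {y | R y x} : Set L) ∧
          IsClosed (Subtype.val ⁻¹' {y | R x y} : Set L)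
    ] := by
  have h : IsDensePreorderOn X R := ⟨hcomp, htrans, hdense⟩
  have hU : ∀ x ∈ X, SepOrdConnected {y ∈ X | R y x} := fun x hx =>
    (hscU x hx).sepOrdConnected (sep_subset _ _)
  have hL : ∀ x ∈ X, SepOrdConnected {y ∈ X | R x y} := fun x hx =>
    (hscL x hx).sepOrdConnected (sep_subset _ _)
  have hgraph := h.isClosed_graph hXconv hXA hU hL
  tfae_have 1 → 2 := fun hg x hx =>
    ⟨hg.preimage (f := fun y : X => (y, (⟨x, hx⟩ : X))) (by fun_prop),
      hg.preimage (f := fun y : X => ((⟨x, hx⟩ : X), y)) (by fun_prop)⟩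
  tfae_have 2 → 3 := by
    rintro hc x hx L ⟨p, v, -, rfl⟩
    exact ⟨(hc x hx).1.preimage (continuous_inclusion inter_subset_left),
      (hc x hx).2.preimage (continuous_inclusion inter_subset_left)⟩
  tfae_have 3 → 11 := by
    rintro hc x hx L ⟨p, i, rfl⟩
    exact hc x hx _ ⟨p, Pi.single i 1, by simp, rfl⟩
  tfae_have 11 → 1 := fun hc => hgraph
    (fun x hx => h.swap.sepOpenIn_strictLower_of_isClosed hx fun L hLL => (hc x hx L hLL).2)
    (fun x hx => h.sepOpenIn_strictLower_of_isClosed hx fun L hLL => (hc x hx L hLL).1)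
  tfae_have 2 → 4 := fun hc x hx y hy z hz =>
    ⟨isClosed_weights hXconv hx hy (hc z hz).1, isClosed_weights hXconv hx hy (hc z hz).2⟩
  tfae_have 4 → 5 := fun hc x hx y hy z hz hxy =>
    ⟨exists_weight_spref_of_isClosed h hXconv hx hy hz hxy (hc x hx z hz y hy).2,
      exists_weight_spref_of_isClosed h.swap hXconv hy hx hz hxy (hc y hy z hz x hx).1⟩
  tfae_have 5 → 1 := fun ha => hgraph
    (fun x hx => h.swap.sepOpenIn_strictLower_of_archimedean hXconv hU hx
      fun y hy z hz hyx => (ha y hy x hx z hz hyx).1)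
    (fun x hx => h.sepOpenIn_strictLower_of_archimedean hXconv hL hx
      fun y hy z hz hxy => (ha x hx y hy z hz hxy).2)
  tfae_have 2 → 6 := fun hc x _ y hy z _ hxy hyz C hC =>
    h.exists_indiff_of_curve hc hy hxy hyz hC
  tfae_have 6 → 7 := by
    intro hi x hx y hy z hz hxy hyz
    rcases eq_or_ne x z with rfl | hxz
    · exact ⟨1, by simp, by simpa using hxy, by simpa using hyz⟩
    · obtain ⟨C, hC, hCl⟩ := exists_isCurveJoining_segment hXconv hx hz hxz
      obtain ⟨c, hc, hcy⟩ := hi x hx y hy z hz hxy hyz C hC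
      obtain ⟨l, hl, rfl⟩ := hCl c hc
      exact ⟨l, hl, hcy⟩
  tfae_have 6 → 8 := fun hi =>
    ⟨hdense, fun x hx z hz y hy hxz hzy C hC => hi x hx z hz y hy hxz.1 hzy.1 C hC⟩
  tfae_have 7 → 9 := fun hi =>
    ⟨hdense, fun x hx z hz y hy hxz hzy => hi x hx z hz y hy hxz.1 hzy.1⟩
  tfae_have 8 → 9 := by
    refine fun hw => ⟨hw.1, fun x hx z hz y hy hxz hzy => ?_⟩
    have hxy : x ≠ y := by
      rintro rfl
      exact hxz.2 hzy.1
    obtain ⟨C, hC, hCl⟩ := exists_isCurveJoining_segment hXconv hx hy hxy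
    obtain ⟨c, hc, hcz⟩ := hw.2 x hx z hz y hy hxz hzy C hC
    obtain ⟨l, hl, rfl⟩ := hCl c hc
    exact ⟨l, hl, hcz⟩
  tfae_have 9 → 10 := by
    intro hw i x hx y a b ha hb hax hxb
    by_cases hxa : R x (update y i a)
    · exact ⟨a, ha, hxa, hax⟩
    by_cases hbx : R (update y i b) x
    · exact ⟨b, hb, hxb, hbx⟩
    obtain ⟨l, hl, hlx⟩ := hw.2 _ ha x hx _ hb ⟨hax, hxa⟩ ⟨hxb, hbx⟩
    have hmem := hXconv.smul_add_one_sub_smul_mem ha hb hl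
    rw [smul_update_add_smul_update] at hlx hmem
    exact ⟨_, hmem, hlx.2, hlx.1⟩
  tfae_have 10 → 1 := fun hs => hgraph
    (fun x hx => h.swap.sepOpenIn_strictLower_of_restrictedSolvable hL hU
      (fun i x hx y a b ha hb hax hxb =>
        (hs i x hx y b a hb ha hxb hax).imp fun _ hc => ⟨hc.1, hc.2.2, hc.2.1⟩) hx)
    (fun x hx => h.sepOpenIn_strictLower_of_restrictedSolvable hU hL hs hx)
  tfae_finish
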